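/- The relative height function on prime ideals of S_n is additive, and consequently S_n is a catenary algebra: for all prime two-sided ideals P_1 ⊆ P_2 ⊆ P_3 of S_n one has ht(P_3, P_1) = ht(P_3, P_2) + ht(P_2, P_1), and ht(P_2, P_1) = ht(P_2) − ht(P_1); in particular every chain of prime ideals from P_1 to P_3 admits a refinement of length ht(P_3, P_1). -/

import Mathlib

set_option synthInstance.maxHeartbeats 1000000
set_option maxHeartbeats 1000000

open MvPolynomial

noncomputable section

/-- The polynomial algebra `P_n = K[x_1, …, x_n]`. -/
abbrev PolyAlg (K : Type u) [Field K] (n : ℕ) := MvPolynomial (Fin n) K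

/-- `X_i` : multiplication by the variable `x_i`, as a `K`-linear endomorphism of `P_n`. -/
def Xop (K : Type u) [Field K] (n : ℕ) (i : Fin n) : Module.End K (PolyAlg K n) :=
  LinearMap.mulLeft K (X i)

/-- `Y_i` : the left inverse of `X_i`, sending a monomial `x^α` to `x^{α - e_i}` if `α i ≥ 1`
and to `0` otherwise. -/
def Yop (K : Type u) [Field K] (n : ℕ) (i : Fin n) : Module.End K (PolyAlg K n) :=
  (basisMonomials (Fin n) K).constr K fun α =>
    if α i = 0 then 0 else monomial (α - Finsupp.single i 1) (1 : K)

/-- The algebra `S_n` of one-sided inverses of `P_n` : the subalgebra of `End_K(P_n)`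
generated by `X_1, …, X_n, Y_1, …, Y_n`. -/
def SnAlg (K : Type u) [Field K] (n : ℕ) : Subalgebra K (Module.End K (PolyAlg K n)) :=
  Algebra.adjoin K (Set.range (Xop K n) ∪ Set.range (Yop K n))

/-- `x_i` as an element of `S_n`. -/
def xS (K : Type u) [Field K] (n : ℕ) (i : Fin n) : SnAlg K n :=
  ⟨Xop K n i, Algebra.subset_adjoin (Set.mem_union_left _ ⟨i, rfl⟩)⟩

/-- `y_i` as an element of `S_n`. -/
def yS (K : Type u) [Field K] (n : ℕ) (i : Fin n) : SnAlg K n :=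
  ⟨Yop K n i, Algebra.subset_adjoin (Set.mem_union_right _ ⟨i, rfl⟩)⟩

/-- The product `I*J` of two two-sided ideals: the two-sided ideal generated by all products
`a * b` with `a ∈ I`, `b ∈ J`. -/
def tsiMul {R : Type*} [Ring R] (I J : TwoSidedIdeal R) : TwoSidedIdeal R :=
  TwoSidedIdeal.span {x | ∃ a ∈ I, ∃ b ∈ J, x = a * b}

/-- A two-sided ideal `P` of a ring is prime if it is proper and for all two-sided ideals
`I`, `J`, `I*J ⊆ P` implies `I ⊆ P` or `J ⊆ P`. -/
def tsiPrime {R : Type*} [Ring R] (P : TwoSidedIdeal R) : Prop :=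
  P ≠ ⊤ ∧ ∀ I J : TwoSidedIdeal R, tsiMul I J ≤ P → I ≤ P ∨ J ≤ P

/-- There is a strictly increasing chain of prime two-sided ideals
`f 0 ⊊ f 1 ⊊ ⋯ ⊊ f m = P` of length `m` ending at `P`. -/
def primeChainTo {R : Type*} [Ring R] (P : TwoSidedIdeal R) (m : ℕ) : Prop :=
  ∃ f : Fin (m + 1) → TwoSidedIdeal R,
    StrictMono f ∧ (∀ i, tsiPrime (f i)) ∧ f (Fin.last m) = P

/-- There is a strictly increasing chain of prime two-sided ideals
`P = f 0 ⊊ f 1 ⊊ ⋯ ⊊ f m` of length `m` starting at `P`. -/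
def primeChainFrom {R : Type*} [Ring R] (P : TwoSidedIdeal R) (m : ℕ) : Prop :=
  ∃ f : Fin (m + 1) → TwoSidedIdeal R,
    StrictMono f ∧ (∀ i, tsiPrime (f i)) ∧ f 0 = P

/-- The height of the prime two-sided ideal `P` is `h` : there is a chain of primes of length `h`
ending at `P` and every such chain has length at most `h`. -/
def heightIs {R : Type*} [Ring R] (P : TwoSidedIdeal R) (h : ℕ) : Prop :=
  primeChainTo P h ∧ ∀ m, primeChainTo P m → m ≤ h

/-- The co-height of the prime two-sided ideal `P` (the classical Krull dimension of `R/P`) is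
`c` : there is a chain of primes of length `c` starting at `P` and every such chain has length
at most `c`. -/
def coheightIs {R : Type*} [Ring R] (P : TwoSidedIdeal R) (c : ℕ) : Prop :=
  primeChainFrom P c ∧ ∀ m, primeChainFrom P m → m ≤ c

/-- There is a strictly increasing chain of prime two-sided ideals
`P = f 0 ⊊ f 1 ⊊ ⋯ ⊊ f m = Q` of length `m` from `P` to `Q`. -/
def primeChainBetween {R : Type*} [Ring R] (P Q : TwoSidedIdeal R) (m : ℕ) : Prop :=
  ∃ f : Fin (m + 1) → TwoSidedIdeal R,
    StrictMono f ∧ (∀ i, tsiPrime (f i)) ∧ f 0 = P ∧ f (Fin.last m) = Q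

/-- The relative height `ht(Q, P)` of the pair of primes `P ⊆ Q` is `h` : there is a chain of
primes from `P` to `Q` of length `h`, and every such chain has length at most `h`. -/
def relHeightIs {R : Type*} [Ring R] (P Q : TwoSidedIdeal R) (h : ℕ) : Prop :=
  primeChainBetween P Q h ∧ ∀ m, primeChainBetween P Q m → m ≤ h

/-- If a strictly antitone rank function `σ` on a poset admits intermediate elements whenever it
drops by more than one, then every chain from `P` to `Q` refines to one of length `σ P - σ Q`. -/
theorem exists_refinement_of_rank {X : Type*} [PartialOrder X] (p : X → Prop) (σ : X → ℕ)
    (hanti : ∀ P Q, p P → p Q → P < Q → σ Q < σ P)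
    (hbetw : ∀ P Q, p P → p Q → P < Q → σ Q + 1 < σ P → ∃ R, p R ∧ P < R ∧ R < Q)
    (P Q : X) (hP : p P) (hQ : p Q) (hPQ : P ≤ Q) (m : ℕ) (g : Fin (m + 1) → X)
    (hg : StrictMono g) (hgp : ∀ i, p (g i)) (hg0 : g 0 = P) (hgl : g (Fin.last m) = Q) :
    ∃ f : Fin (σ P - σ Q + 1) → X, StrictMono f ∧ (∀ i, p (f i)) ∧ f 0 = P ∧
      f (Fin.last (σ P - σ Q)) = Q ∧ Set.range g ⊆ Set.range f := by
  classical
  let Y := {x : X // p x ∧ P ≤ x ∧ x ≤ Q}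
  have hgm (i) : p (g i) ∧ P ≤ g i ∧ g i ≤ Q :=
    ⟨hgp i, hg0 ▸ hg.monotone (Fin.zero_le i), hgl ▸ hg.monotone (Fin.le_last i)⟩
  let g' : Fin (m + 1) → Y := fun i => ⟨g i, hgm i⟩
  have hg' : Monotone g' := fun i j hij => hg.monotone hij
  obtain ⟨C, hC⟩ := (Monotone.isChain_range hg').exists_subset_flag
  have hgC (i) : g' i ∈ C := hC ⟨i, rfl⟩
  let P' : Y := ⟨P, hP, le_rfl, hPQ⟩
  let Q' : Y := ⟨Q, hQ, hPQ, le_rfl⟩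
  have hPC : P' ∈ C := by
    have : P' = g' 0 := Subtype.ext hg0.symm
    exact this ▸ hgC 0
  have hQC : Q' ∈ C := by
    have : Q' = g' (Fin.last m) := Subtype.ext hgl.symm
    exact this ▸ hgC _
  have hlt {a b : Y} (h : a < b) : σ b < σ a := hanti _ _ a.2.1 b.2.1 h
  have hle {a b : Y} (h : a ≤ b) : σ b ≤ σ a := by
    rcases h.eq_or_lt with rfl | h
    · exact le_rfl
    · exact (hlt h).le
  have hlt' {a b : Y} (ha : a ∈ C) (hb : b ∈ C) (h : σ b < σ a) : a < b := by
    rcases C.chain_le.total ha hb with h' | h'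
    · exact lt_of_le_of_ne h' (by rintro rfl; exact lt_irrefl _ h)
    · exact absurd (hle h') (not_le.2 h)
  have hsurj (k : ℕ) (h1 : σ Q ≤ k) (h2 : k ≤ σ P) : ∃ c ∈ C, σ (c : Y).1 = k := by
    by_contra! hk
    have hkP : k < σ P := lt_of_le_of_ne h2 (hk P' hPC).symm
    have hQk : σ Q < k := lt_of_le_of_ne h1 (hk Q' hQC)
    have hex1 : ∃ d, ∃ c ∈ C, k < σ (c : Y).1 ∧ σ c.1 = d := ⟨_, P', hPC, hkP, rfl⟩
    obtain ⟨c₁, hc₁, hkc₁, hd₁⟩ := Nat.find_spec hex1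
    have hmin₁ (c : Y) (hc : c ∈ C) (h : k < σ c.1) : σ c₁.1 ≤ σ c.1 :=
      hd₁ ▸ Nat.find_min' hex1 ⟨c, hc, h, rfl⟩
    have hex2 : ∃ d, ∃ c ∈ C, σ (c : Y).1 < k ∧ k - σ c.1 = d := ⟨_, Q', hQC, hQk, rfl⟩
    obtain ⟨c₂, hc₂, hkc₂, hd₂⟩ := Nat.find_spec hex2
    have hmin₂ (c : Y) (hc : c ∈ C) (h : σ c.1 < k) : k - σ c₂.1 ≤ k - σ c.1 :=
      hd₂ ▸ Nat.find_min' hex2 ⟨c, hc, h, rfl⟩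
    obtain ⟨R, hR, hcR, hRc⟩ := hbetw c₁.1 c₂.1 c₁.2.1 c₂.2.1
      (hlt' hc₁ hc₂ (hkc₂.trans hkc₁)) (by omega)
    let R' : Y := ⟨R, hR, c₁.2.2.1.trans hcR.le, hRc.le.trans c₂.2.2.2⟩
    have hR₁ : c₁ < R' := hcR
    have hR₂ : R' < c₂ := hRc
    have hins : IsChain (· ≤ ·) (insert R' (C : Set Y)) := by
      refine C.chain_le.insert fun b hb hne => ?_
      rcases lt_trichotomy (σ b.1) k with h | h | h
      · left
        rcases C.chain_le.total hc₂ hb with h' | h'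
        · exact hR₂.le.trans h'
        · rcases h'.eq_or_lt with rfl | h'
          · exact hR₂.le
          · have := hlt h'
            have := hmin₂ b hb h
            omega
      · exact absurd h (hk b hb)
      · right
        rcases C.chain_le.total hb hc₁ with h' | h'
        · exact h'.trans hR₁.le
        · rcases h'.eq_or_lt with rfl | h'
          · exact hR₁.le
          · have := hlt h'
            have := hmin₁ b hb h
            omega
    have hRC : R' ∈ C := by
      have := C.max_chain' hins (Set.subset_insert _ _)
      change R' ∈ C.carrier
      rw [this]
      exact Set.mem_insert _ _
    have h₁ := hlt hR₁
    have h₂ := hlt hR₂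
    rcases lt_trichotomy (σ R) k with h | h | h
    · have := hmin₂ R' hRC h
      change σ R < _ at h₁
      change _ < σ R at h₂
      change k - _ ≤ k - σ R at this
      omega
    · exact hk R' hRC h
    · have := hmin₁ R' hRC h
      change _ ≤ σ R at this
      change σ R < _ at h₁
      omega
  have hσ : σ Q ≤ σ P := hle (a := P') (b := Q') hPQ
  choose f hfC hf using fun i : Fin (σ P - σ Q + 1) => hsurj (σ P - i) (by omega) (by omega)
  have hinj {a b : Y} (ha : a ∈ C) (hb : b ∈ C) (h : σ a.1 = σ b.1) : a = b := by
    by_contra hne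
    rcases C.chain_le.total ha hb with h' | h'
    · exact (hlt (lt_of_le_of_ne h' hne)).ne' h
    · exact (hlt (lt_of_le_of_ne h' (Ne.symm hne))).ne h
  refine ⟨fun i => (f i).1, fun i j hij => ?_, fun i => (f i).2.1, ?_, ?_, ?_⟩
  · refine hlt' (hfC i) (hfC j) ?_
    rw [hf, hf]
    have := i.2
    have := j.2
    have : i.1 < j.1 := hij
    omega
  · exact congrArg Subtype.val (hinj (hfC 0) hPC (by rw [hf]; simp [P']))
  · refine congrArg Subtype.val (hinj (hfC _) hQC ?_)
    rw [hf]
    simp only [Fin.val_last, Q']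
    omega
  · rintro _ ⟨i, rfl⟩
    have h1 : σ Q ≤ σ (g i) := hle (a := g' i) (b := Q') (hgm i).2.2
    have h2 : σ (g i) ≤ σ P := hle (a := P') (b := g' i) (hgm i).2.1
    refine ⟨⟨σ P - σ (g i), by omega⟩, congrArg Subtype.val (hinj (hfC _) (hgC i) ?_)⟩
    rw [hf]
    simp only [g']
    omega

theorem length_le_of_rank {X : Type*} [PartialOrder X] (p : X → Prop) (σ : X → ℕ)
    (hanti : ∀ P Q, p P → p Q → P < Q → σ Q < σ P) (m : ℕ) (g : Fin (m + 1) → X)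
    (hg : StrictMono g) (hgp : ∀ i, p (g i)) : σ (g (Fin.last m)) + m ≤ σ (g 0) := by
  have key (k : ℕ) (hk : k < m + 1) : σ (g ⟨k, hk⟩) + k ≤ σ (g 0) := by
    induction k with
    | zero => exact le_rfl
    | succ k ih =>
      have h1 := ih (by omega)
      have h2 := hanti _ _ (hgp ⟨k, by omega⟩) (hgp ⟨k + 1, hk⟩)
        (hg (show (⟨k, by omega⟩ : Fin (m + 1)) < ⟨k + 1, hk⟩ from Nat.lt_succ_self k))
      omega
  exact key m (Nat.lt_succ_self m)

theorem exists_chain_of_le {X : Type*} [PartialOrder X] (p : X → Prop) (P Q : X) (hP : p P)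
    (hQ : p Q) (h : P ≤ Q) : ∃ (m : ℕ) (g : Fin (m + 1) → X),
      StrictMono g ∧ (∀ i, p (g i)) ∧ g 0 = P ∧ g (Fin.last m) = Q := by
  rcases h.eq_or_lt with rfl | h
  · exact ⟨0, fun _ => P, fun i j hij => absurd hij (by omega), fun _ => hP, rfl, rfl⟩
  · refine ⟨1, ![P, Q], ?_, ?_, rfl, rfl⟩
    · rw [Fin.strictMono_iff_lt_succ]
      intro i
      fin_cases i
      exact h
    · intro i
      fin_cases i
      · exact hP
      · exact hQ

/-- Relative heights, heights and refinements of chains of primes, computed from a rank function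
with a least prime. -/
theorem additive_of_rank {R : Type*} [Ring R] (σ : TwoSidedIdeal R → ℕ)
    (hanti : ∀ P Q, tsiPrime P → tsiPrime Q → P < Q → σ Q < σ P)
    (hbetw : ∀ P Q : TwoSidedIdeal R, tsiPrime P → tsiPrime Q → P < Q → σ Q + 1 < σ P →
      ∃ R, tsiPrime R ∧ P < R ∧ R < Q)
    (hmin : ∃ P₀ : TwoSidedIdeal R, tsiPrime P₀ ∧ ∀ P, tsiPrime P → P₀ ≤ P)
    (P₁ P₂ P₃ : TwoSidedIdeal R) (h1 : tsiPrime P₁) (h2 : tsiPrime P₂) (h3 : tsiPrime P₃)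
    (h12 : P₁ ≤ P₂) (h23 : P₂ ≤ P₃) :
    ∃ r12 r23 r13 ht1 ht2 : ℕ,
      relHeightIs P₁ P₂ r12 ∧ relHeightIs P₂ P₃ r23 ∧ relHeightIs P₁ P₃ r13 ∧
      heightIs P₁ ht1 ∧ heightIs P₂ ht2 ∧
      r13 = r23 + r12 ∧
      r12 + ht1 = ht2 ∧
      ∀ (m : ℕ) (g : Fin (m + 1) → TwoSidedIdeal R),
        StrictMono g → (∀ i, tsiPrime (g i)) → g 0 = P₁ → g (Fin.last m) = P₃ →
        ∃ f : Fin (r13 + 1) → TwoSidedIdeal R,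
          StrictMono f ∧ (∀ i, tsiPrime (f i)) ∧ f 0 = P₁ ∧ f (Fin.last r13) = P₃ ∧
          Set.range g ⊆ Set.range f := by
  obtain ⟨P₀, h0, hP₀⟩ := hmin
  have hmono (P Q) (hP : tsiPrime P) (hQ : tsiPrime Q) (h : P ≤ Q) : σ Q ≤ σ P := by
    rcases h.eq_or_lt with rfl | h
    · exact le_rfl
    · exact (hanti _ _ hP hQ h).le
  have hrel (P Q) (hP : tsiPrime P) (hQ : tsiPrime Q) (h : P ≤ Q) :
      relHeightIs P Q (σ P - σ Q) := by
    constructor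
    · obtain ⟨m, g, hg, hgp, hg0, hgl⟩ := exists_chain_of_le _ P Q hP hQ h
      obtain ⟨f, hf, hfp, hf0, hfl, -⟩ :=
        exists_refinement_of_rank _ σ hanti hbetw P Q hP hQ h m g hg hgp hg0 hgl
      exact ⟨f, hf, hfp, hf0, hfl⟩
    · rintro m ⟨f, hf, hfp, rfl, rfl⟩
      have := length_le_of_rank _ σ hanti m f hf hfp
      omega
  have hht (P) (hP : tsiPrime P) : heightIs P (σ P₀ - σ P) := by
    constructor
    · obtain ⟨f, hf, hfp, -, hfl⟩ := (hrel P₀ P h0 hP (hP₀ P hP)).1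
      exact ⟨f, hf, hfp, hfl⟩
    · rintro m ⟨f, hf, hfp, rfl⟩
      have := length_le_of_rank _ σ hanti m f hf hfp
      have := hmono _ _ h0 (hfp 0) (hP₀ _ (hfp 0))
      omega
  have i1 := hmono _ _ h0 h1 (hP₀ _ h1)
  have i2 := hmono _ _ h1 h2 h12
  have i3 := hmono _ _ h2 h3 h23
  exact ⟨_, _, _, _, _, hrel _ _ h1 h2 h12, hrel _ _ h2 h3 h23, hrel _ _ h1 h3 (h12.trans h23),
    hht _ h1, hht _ h2, by omega, by omega,
    exists_refinement_of_rank _ σ hanti hbetw _ _ h1 h3 (h12.trans h23)⟩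

theorem ringKrullDim_le_of_isIntegral (A B : Type*) [CommRing A] [CommRing B] [Algebra A B]
    [Algebra.IsIntegral A B] : ringKrullDim B ≤ ringKrullDim A := by
  refine Order.krullDim_le_of_strictMono (PrimeSpectrum.comap (algebraMap A B)) fun I J h => ?_
  exact Ideal.IsIntegral.comap_lt_comap h

theorem le_ringKrullDim_of_isIntegral (A B : Type*) [CommRing A] [CommRing B] [Algebra A B]
    [Algebra.IsIntegral A B] [FaithfulSMul A B] : ringKrullDim A ≤ ringKrullDim B := by
  refine iSup_le fun l => ?_
  obtain ⟨Q, -, hQ, hQl⟩ := Ideal.exists_ideal_over_prime_of_isIntegral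
    (S := B) l.head.asIdeal ⊥ (by
      rw [← RingHom.ker_eq_comap_bot, (RingHom.injective_iff_ker_eq_bot _).1
        (FaithfulSMul.algebraMap_injective A B)]
      exact bot_le)
  have : Q.LiesOver l.head.asIdeal := ⟨hQl.symm⟩
  obtain ⟨L, hL, -⟩ := Ideal.exists_ltSeries_of_hasGoingUp l Q
  exact le_iSup_of_le L (by rw [hL])

theorem MvPolynomial.natCard_le_height_of_isMaximal {K : Type*} [Field K] {σ : Type*} [Finite σ]
    (m : Ideal (MvPolynomial σ K)) [m.IsMaximal] : (Nat.card σ : ℕ∞) ≤ m.height := by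
  revert m
  induction σ using Finite.induction_empty_option with
  | of_equiv e H =>
    intro m hm
    have hm' : (m.comap (renameEquiv K e).toRingEquiv).IsMaximal :=
      Ideal.comap_isMaximal_of_equiv (renameEquiv K e).toRingEquiv
    rw [← Nat.card_congr e, ← RingEquiv.height_comap (renameEquiv K e).toRingEquiv]
    exact H _
  | h_empty => intro m hm; simp
  | h_option H =>
    intro m hm
    rename_i α _
    let e := (optionEquivLeft K α).toRingEquiv.symm
    have hm' : (m.comap e).IsMaximal := Ideal.comap_isMaximal_of_equiv e
    rw [← RingEquiv.height_comap e,
      Polynomial.height_eq_height_add_one ((m.comap e).under (MvPolynomial α K)) (m.comap e)]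
    have : ((m.comap e).under (MvPolynomial α K)).IsMaximal :=
      Polynomial.isMaximal_comap_C_of_isJacobsonRing _
    have h := H ((m.comap e).under (MvPolynomial α K))
    rw [Finite.card_option]
    push_cast
    gcongr

/-- A saturated step `0 ⊂ p` in the spectrum of an affine domain lowers the dimension by at
most one. -/
theorem ringKrullDim_le_quotient_add_one (K : Type*) {B : Type*} [Field K] [CommRing B] [IsDomain B]
    [Algebra K B] [Algebra.FiniteType K B] (p : Ideal B) [p.IsPrime]
    (hp : ∀ r : Ideal B, r.IsPrime → r < p → r = ⊥) :
    ringKrullDim B ≤ ringKrullDim (B ⧸ p) + 1 := by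
  obtain ⟨s, g, hg, hgi⟩ := exists_integral_inj_algHom_of_fg K B
  let C := MvPolynomial (Fin s) K
  let : Algebra C B := g.toRingHom.toAlgebra
  have : Algebra.IsIntegral C B := ⟨hgi⟩
  have : FaithfulSMul C B := (faithfulSMul_iff_algebraMap_injective C B).2 hg
  let c : Ideal C := p.under C
  have hc : ∀ r : Ideal C, r.IsPrime → r < c → r = ⊥ := by
    intro r hr hrc
    obtain ⟨r', hr'p, hr', hr'r⟩ := Ideal.exists_ideal_lt_liesOver_of_lt (p := r) (q := c) p hrc
    have := hp r' hr' hr'p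
    subst this
    rw [hr'r.over]
    exact (RingHom.injective_iff_ker_eq_bot _).1 hg
  obtain ⟨f, hf⟩ : ∃ f : C, c = Ideal.span {f} := by
    by_cases hc0 : c = ⊥
    · exact ⟨0, by rw [hc0]; simp⟩
    obtain ⟨x, hx, hxp⟩ := Ideal.IsPrime.exists_mem_prime_of_ne_bot
      (inferInstance : c.IsPrime) hc0
    refine ⟨x, ?_⟩
    by_contra hne
    have hpr : (Ideal.span {x}).IsPrime := (Ideal.span_singleton_prime hxp.ne_zero).2 hxp
    have := hc _ hpr (lt_of_le_of_ne ((Ideal.span_singleton_le_iff_mem _).2 hx) (Ne.symm hne))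
    exact hxp.ne_zero (by simpa using this)
  obtain ⟨m, hm, hcm⟩ := Ideal.exists_le_maximal c Ideal.IsPrime.ne_top'
  have hfm : f ∈ m := hcm (hf ▸ Ideal.mem_span_singleton_self f)
  have h1 : ringKrullDim B ≤ (s : WithBot ℕ∞) := by
    refine (ringKrullDim_le_of_isIntegral C B).trans ?_
    simp [C, MvPolynomial.ringKrullDim_of_isNoetherianRing]
  have h2 : (s : WithBot ℕ∞) ≤ m.height := by
    have := MvPolynomial.natCard_le_height_of_isMaximal m
    rw [Nat.card_eq_fintype_card, Fintype.card_fin] at this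
    exact_mod_cast this
  have h3 := Ideal.height_le_ringKrullDim_quotient_add_one hfm
  rw [← hf] at h3
  have h4 : ringKrullDim (C ⧸ c) ≤ ringKrullDim (B ⧸ p) :=
    le_ringKrullDim_of_isIntegral (C ⧸ c) (B ⧸ p)
  exact h1.trans (h2.trans (h3.trans (by gcongr)))

theorem exists_prime_between_of_ringKrullDim {K A : Type*} [Field K] [CommRing A] [Algebra K A]
    [Algebra.FiniteType K A] (q q' : Ideal A) [q.IsPrime] [q'.IsPrime] (h : q < q')
    (hd : ringKrullDim (A ⧸ q') + 1 < ringKrullDim (A ⧸ q)) :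
    ∃ r : Ideal A, r.IsPrime ∧ q < r ∧ r < q' := by
  by_contra! hno
  let p := q'.map (Ideal.Quotient.mk q)
  have hpp : p.IsPrime := Ideal.map_isPrime_of_surjective Ideal.Quotient.mk_surjective
    (by rw [Ideal.mk_ker]; exact h.le)
  have hcp : p.comap (Ideal.Quotient.mk q) = q' := by
    rw [Ideal.comap_map_of_surjective _ Ideal.Quotient.mk_surjective, ← RingHom.ker_eq_comap_bot,
      Ideal.mk_ker, sup_eq_left]
    exact h.le
  have key := ringKrullDim_le_quotient_add_one K p (fun r hr hrp => by
    by_contra hr0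
    refine hno (r.comap (Ideal.Quotient.mk q)) inferInstance ?_ ?_
    · refine lt_of_le_of_ne ?_ ?_
      · conv_lhs => rw [← Ideal.mk_ker (I := q), RingHom.ker_eq_comap_bot]
        exact Ideal.comap_mono bot_le
      · intro he
        apply hr0
        rw [← Ideal.map_comap_of_surjective _ Ideal.Quotient.mk_surjective r, ← he]
        exact Ideal.map_quotient_self q
    · rw [← hcp]
      refine lt_of_le_of_ne (Ideal.comap_mono hrp.le) fun he => hrp.ne ?_
      exact Ideal.comap_injective_of_surjective _ Ideal.Quotient.mk_surjective he)
  have e := ringKrullDim_eq_of_ringEquiv (DoubleQuot.quotQuotEquivQuotOfLE h.le)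
  rw [e] at key
  exact absurd hd (not_lt.2 key)

theorem ringKrullDim_quotient_add_one_le {A : Type*} [CommRing A] (q q' : Ideal A) [q.IsPrime]
    (h : q < q') : ringKrullDim (A ⧸ q') + 1 ≤ ringKrullDim (A ⧸ q) := by
  obtain ⟨x, hx', hx⟩ := SetLike.exists_of_lt h
  refine ringKrullDim_succ_le_of_surjective (Ideal.Quotient.factor h.le)
    (Ideal.Quotient.factor_surjective h.le) (r := Ideal.Quotient.mk q x) ?_ ?_
  · rw [mem_nonZeroDivisors_iff_ne_zero]
    exact fun h0 => hx (Ideal.Quotient.eq_zero_iff_mem.1 h0)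
  · simpa using Ideal.Quotient.eq_zero_iff_mem.2 hx'

theorem MvPolynomial.map_rename_isPrime {K : Type*} [Field K] {σ τ υ : Type*} (e : υ ⊕ σ ≃ τ)
    [Finite σ] [Finite υ] (q : Ideal (MvPolynomial σ K)) [q.IsPrime] :
    (q.map (rename (R := K) (e ∘ Sum.inr))).IsPrime ∧
      ringKrullDim (MvPolynomial τ K ⧸ q.map (rename (R := K) (e ∘ Sum.inr))) =
        ringKrullDim (MvPolynomial σ K ⧸ q) + Nat.card υ := by
  let E : MvPolynomial τ K ≃+* MvPolynomial υ (MvPolynomial σ K) :=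
    ((renameEquiv K e.symm).trans (sumAlgEquiv K υ σ)).toRingEquiv
  have hE : E.toRingHom.comp (rename (R := K) (e ∘ Sum.inr)).toRingHom = C := by
    ext i <;> simp [E]
  have hmap : (q.map (rename (R := K) (e ∘ Sum.inr))).map E.toRingHom =
      q.map (C : MvPolynomial σ K →+* MvPolynomial υ (MvPolynomial σ K)) := by
    rw [← hE, ← Ideal.map_map]
    rfl
  let F : (MvPolynomial τ K ⧸ q.map (rename (R := K) (e ∘ Sum.inr))) ≃+*
      MvPolynomial υ (MvPolynomial σ K ⧸ q) :=
    (Ideal.quotientEquiv _ _ E hmap.symm).trans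
      (MvPolynomial.quotientEquivQuotientMvPolynomial (σ := υ) q).toRingEquiv.symm
  constructor
  · rw [← Ideal.Quotient.isDomain_iff_prime]
    exact F.toMulEquiv.isDomain
  · rw [ringKrullDim_eq_of_ringEquiv F,
      MvPolynomial.ringKrullDim_of_isNoetherianRing]

theorem tsiPrime.mem_or_mem {R : Type*} [Ring R] {P : TwoSidedIdeal R} (hP : tsiPrime P) {a b : R}
    (h : ∀ s, a * s * b ∈ P) : a ∈ P ∨ b ∈ P := by
  let I : TwoSidedIdeal R := TwoSidedIdeal.mk' {u | ∀ s, u * s * b ∈ P}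
    (fun s => by simp)
    (fun {u v} hu hv s => by simpa only [add_mul] using P.add_mem (hu s) (hv s))
    (fun {u} hu s => by simpa only [neg_mul] using P.neg_mem (hu s))
    (fun {t u} hu s => by simpa only [mul_assoc] using P.mul_mem_left t _ (hu s))
    (fun {u t} hu s => by simpa only [mul_assoc] using hu (t * s))
  have hI : ∀ u, u ∈ I ↔ ∀ s, u * s * b ∈ P := fun u => TwoSidedIdeal.mem_mk' _ _ _ _ _ _ _
  let J : TwoSidedIdeal R := TwoSidedIdeal.mk' {v | ∀ u ∈ I, ∀ s, u * s * v ∈ P}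
    (fun u _ s => by simp)
    (fun {v w} hv hw u hu s => by simpa only [mul_add] using P.add_mem (hv u hu s) (hw u hu s))
    (fun {v} hv u hu s => by simpa only [mul_neg] using P.neg_mem (hv u hu s))
    (fun {t v} hv u hu s => by simpa only [mul_assoc] using hv u hu (s * t))
    (fun {v t} hv u hu s => by simpa only [mul_assoc] using P.mul_mem_right _ t (hv u hu s))
  have hJ : ∀ v, v ∈ J ↔ ∀ u ∈ I, ∀ s, u * s * v ∈ P :=
    fun v => TwoSidedIdeal.mem_mk' _ _ _ _ _ _ _
  have hIJ : tsiMul I J ≤ P := by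
    refine TwoSidedIdeal.span_le.2 ?_
    rintro _ ⟨u, hu, v, hv, rfl⟩
    simpa using (hJ v).1 hv u hu 1
  exact (hP.2 I J hIJ).imp (fun H => H ((hI a).2 h)) fun H => H ((hJ b).2 fun u hu => (hI u).1 hu)

theorem tsiPrime_of_mem_or_mem {R : Type*} [Ring R] {P : TwoSidedIdeal R} (h1 : (1 : R) ∉ P)
    (h : ∀ a b, (∀ s, a * s * b ∈ P) → a ∈ P ∨ b ∈ P) : tsiPrime P := by
  refine ⟨fun H => h1 (H ▸ trivial), fun I J hIJ => ?_⟩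
  by_contra! hcon
  obtain ⟨a, haI, haP⟩ := SetLike.not_le_iff_exists.1 hcon.1
  obtain ⟨b, hbJ, hbP⟩ := SetLike.not_le_iff_exists.1 hcon.2
  refine (h a b fun s => hIJ (TwoSidedIdeal.subset_span ?_)).elim haP hbP
  exact ⟨a * s, I.mul_mem_right _ _ haI, b, hbJ, rfl⟩

theorem tsiPrime.one_notMem {R : Type*} [Ring R] {P : TwoSidedIdeal R} (hP : tsiPrime P) :
    (1 : R) ∉ P := fun h =>
  hP.1 (eq_top_iff.2 fun a _ => by simpa using P.mul_mem_left a 1 h)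

/-- Families `x`, `y` satisfying the defining relations of the algebra of one-sided inverses. -/
structure OneSidedInverses {ι A : Type*} [Ring A] (x y : ι → A) : Prop where
  inv : ∀ i, y i * x i = 1
  comm_xy : ∀ i j, i ≠ j → Commute (x i) (y j)
  comm_xx : ∀ i j, Commute (x i) (x j)
  comm_yy : ∀ i j, Commute (y i) (y j)

namespace OneSidedInverses

variable {K ι A : Type*} [Field K] [Ring A] [Algebra K A] {x y : ι → A}

variable (K x y) in
/-- The subalgebra generated by the `x i` and `y i` with `i ∈ T`. -/
def sub (T : Set ι) : Subalgebra K A := Algebra.adjoin K (x '' T ∪ y '' T)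

variable (x y) in
/-- The idempotent `1 - x j * y j`. -/
def idem (j : ι) : A := 1 - x j * y j

theorem x_mem_sub {T : Set ι} {j : ι} (hj : j ∈ T) : x j ∈ sub K x y T :=
  Algebra.subset_adjoin (Or.inl ⟨j, hj, rfl⟩)

theorem y_mem_sub {T : Set ι} {j : ι} (hj : j ∈ T) : y j ∈ sub K x y T :=
  Algebra.subset_adjoin (Or.inr ⟨j, hj, rfl⟩)

theorem commute_of_mem_sub (H : OneSidedInverses x y) {T : Set ι} {j : ι} (hj : j ∉ T) {b : A}
    (hb : b ∈ sub K x y T) : Commute b (x j) ∧ Commute b (y j) := by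
  induction hb using Algebra.adjoin_induction with
  | mem b hb =>
    rcases hb with ⟨i, hi, rfl⟩ | ⟨i, hi, rfl⟩
    · exact ⟨H.comm_xx i j, H.comm_xy i j fun h => hj (h ▸ hi)⟩
    · exact ⟨(H.comm_xy j i fun h => hj (h ▸ hi)).symm, H.comm_yy i j⟩
  | algebraMap r => exact ⟨Algebra.commutes r _, Algebra.commutes r _⟩
  | add b c _ _ hb hc => exact ⟨hb.1.add_left hc.1, hb.2.add_left hc.2⟩
  | mul b c _ _ hb hc => exact ⟨hb.1.mul_left hc.1, hb.2.mul_left hc.2⟩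

theorem commute_idem (H : OneSidedInverses x y) {T : Set ι} {j : ι} (hj : j ∉ T) {b : A}
    (hb : b ∈ sub K x y T) : Commute b (idem x y j) :=
  (Commute.one_right b).sub_right
    ((H.commute_of_mem_sub hj hb).1.mul_right (H.commute_of_mem_sub hj hb).2)

theorem y_pow_mul_x_pow (H : OneSidedInverses x y) (j : ι) (k m : ℕ) :
    y j ^ k * x j ^ m = x j ^ (m - k) * y j ^ (k - m) := by
  induction k generalizing m with
  | zero => simp
  | succ k ih =>
    cases m with
    | zero => simp
    | succ m =>
      rw [pow_succ, pow_succ', mul_assoc, ← mul_assoc (y j) (x j), H.inv, one_mul, ih,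
        Nat.add_sub_add_right, Nat.add_sub_add_right]

theorem y_mul_idem (H : OneSidedInverses x y) (j : ι) : y j * idem x y j = 0 := by
  rw [idem, mul_sub, ← mul_assoc, H.inv]; simp

theorem idem_mul_x (H : OneSidedInverses x y) (j : ι) : idem x y j * x j = 0 := by
  rw [idem, sub_mul, mul_assoc, H.inv]; simp

theorem idem_mul_idem (H : OneSidedInverses x y) (j : ι) :
    idem x y j * idem x y j = idem x y j := by
  conv_lhs => enter [1]; rw [idem]
  rw [sub_mul, mul_assoc, H.y_mul_idem j]
  simp

theorem eq_mul_of_mul_idem_eq_zero {j : ι} {b : A} (h : b * idem x y j = 0) :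
    b = b * (x j * y j) := by
  rwa [idem, mul_sub, mul_one, sub_eq_zero] at h

variable (K x y) in
/-- The linear combination `∑ x j ^ k * c * y j ^ l` with coefficients `c` in `sub T`. -/
def expand (T : Set ι) (j : ι) : (ℕ × ℕ →₀ sub K x y T) →ₗ[K] A :=
  Finsupp.lsum K fun p =>
    (LinearMap.mulLeft K (x j ^ p.1)).comp
      ((LinearMap.mulRight K (y j ^ p.2)).comp (sub K x y T).val.toLinearMap)

theorem expand_apply (T : Set ι) (j : ι) (b : ℕ × ℕ →₀ sub K x y T) :
    expand K x y T j b = b.sum fun p c => x j ^ p.1 * (c * y j ^ p.2) := rfl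

theorem expand_single (T : Set ι) (j : ι) (k l : ℕ) (c : sub K x y T) :
    expand K x y T j (Finsupp.single (k, l) c) = x j ^ k * (c * y j ^ l) := by
  simp [expand]

theorem exists_expand (H : OneSidedInverses x y) {T : Set ι} {j : ι} (hj : j ∉ T) {a : A}
    (ha : a ∈ sub K x y (insert j T)) : ∃ b, a = expand K x y T j b := by
  have hc := fun c : sub K x y T => H.commute_of_mem_sub hj c.2
  have key : ∀ b b', ∃ d, expand K x y T j b * expand K x y T j b' = expand K x y T j d := by
    intro b b'
    induction b using Finsupp.induction_linear with
    | zero => exact ⟨0, by simp⟩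
    | add f g hf hg =>
      obtain ⟨d, hd⟩ := hf
      obtain ⟨d', hd'⟩ := hg
      exact ⟨d + d', by rw [map_add, map_add, add_mul, hd, hd']⟩
    | single p c =>
      induction b' using Finsupp.induction_linear with
      | zero => exact ⟨0, by simp⟩
      | add f g hf hg =>
        obtain ⟨d, hd⟩ := hf
        obtain ⟨d', hd'⟩ := hg
        exact ⟨d + d', by rw [map_add, map_add, mul_add, hd, hd']⟩
      | single q c' =>
        refine ⟨Finsupp.single (p.1 + (q.1 - p.2), (p.2 - q.1) + q.2) (c * c'), ?_⟩
        rw [expand_single, expand_single, expand_single]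
        have e1 : (c : A) * x j ^ (q.1 - p.2) = x j ^ (q.1 - p.2) * c := (hc c).1.pow_right _
        have e2 : (c' : A) * y j ^ (p.2 - q.1) = y j ^ (p.2 - q.1) * c' := (hc c').2.pow_right _
        calc _ = x j ^ p.1 * (c * ((y j ^ p.2 * x j ^ q.1) * (c' * y j ^ q.2))) := by
              simp only [mul_assoc]
          _ = x j ^ p.1 * ((c * x j ^ (q.1 - p.2)) *
              ((y j ^ (p.2 - q.1) * c') * y j ^ q.2)) := by
              rw [H.y_pow_mul_x_pow]; simp only [mul_assoc]
          _ = _ := by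
              rw [e1, ← e2, pow_add, pow_add]; push_cast; simp only [mul_assoc]
  induction ha using Algebra.adjoin_induction with
  | mem a ha =>
    rcases ha with ⟨i, rfl | hi, rfl⟩ | ⟨i, rfl | hi, rfl⟩
    · exact ⟨Finsupp.single (1, 0) 1, by rw [expand_single]; simp⟩
    · exact ⟨Finsupp.single (0, 0) ⟨_, x_mem_sub hi⟩, by rw [expand_single]; simp⟩
    · exact ⟨Finsupp.single (0, 1) 1, by rw [expand_single]; simp⟩
    · exact ⟨Finsupp.single (0, 0) ⟨_, y_mem_sub hi⟩, by rw [expand_single]; simp⟩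
  | algebraMap r =>
    exact ⟨Finsupp.single (0, 0) (algebraMap K _ r), by rw [expand_single]; simp⟩
  | add a b _ _ ha hb =>
    obtain ⟨d, rfl⟩ := ha
    obtain ⟨d', rfl⟩ := hb
    exact ⟨d + d', by rw [map_add]⟩
  | mul a b _ _ ha hb =>
    obtain ⟨d, rfl⟩ := ha
    obtain ⟨d', rfl⟩ := hb
    exact key d d'

theorem idem_mul_y_pow_mul_x_pow (H : OneSidedInverses x y) (j : ι) (k m : ℕ) :
    idem x y j * (y j ^ k * x j ^ m) = if m ≤ k then idem x y j * y j ^ (k - m) else 0 := by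
  rw [H.y_pow_mul_x_pow]
  split_ifs with h
  · simp [Nat.sub_eq_zero_of_le h]
  · obtain ⟨d, hd⟩ : ∃ d, m - k = d + 1 := ⟨m - k - 1, by omega⟩
    rw [hd, pow_succ', mul_assoc, ← mul_assoc, H.idem_mul_x, zero_mul]

theorem y_pow_mul_x_pow_mul_idem (H : OneSidedInverses x y) (j : ι) (k m : ℕ) :
    y j ^ k * x j ^ m * idem x y j = if k ≤ m then x j ^ (m - k) * idem x y j else 0 := by
  rw [H.y_pow_mul_x_pow]
  split_ifs with h
  · simp [Nat.sub_eq_zero_of_le h]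
  · obtain ⟨d, hd⟩ : ∃ d, k - m = d + 1 := ⟨k - m - 1, by omega⟩
    rw [hd, pow_succ, mul_assoc, mul_assoc, H.y_mul_idem, mul_zero, mul_zero]

theorem idem_mul_term_mul_idem (H : OneSidedInverses x y) {T : Set ι} {j : ι} (hj : j ∉ T) {c : A}
    (hc : c ∈ sub K x y T) (k l p q : ℕ) :
    idem x y j * y j ^ k * (x j ^ p * (c * y j ^ q)) * (x j ^ l * idem x y j) =
      if p ≤ k ∧ q ≤ l ∧ k - p = l - q then c * idem x y j else 0 := by
  have e0 : idem x y j * y j ^ k * (x j ^ p * (c * y j ^ q)) * (x j ^ l * idem x y j) =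
      (idem x y j * (y j ^ k * x j ^ p)) * c * (y j ^ q * x j ^ l * idem x y j) := by
    simp only [mul_assoc]
  rw [e0, H.idem_mul_y_pow_mul_x_pow, H.y_pow_mul_x_pow_mul_idem]
  by_cases hp : p ≤ k
  swap
  · simp [hp]
  by_cases hq : q ≤ l
  swap
  · simp [hq]
  simp only [hp, hq, if_true, true_and]
  have e1 : c * y j ^ (k - p) = y j ^ (k - p) * c := (H.commute_of_mem_sub hj hc).2.pow_right _
  have e2 : c * idem x y j = idem x y j * c := H.commute_idem hj hc
  have e3 : idem x y j * y j ^ (k - p) * c * (x j ^ (l - q) * idem x y j) =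
      c * (idem x y j * (y j ^ (k - p) * x j ^ (l - q)) * idem x y j) := by
    rw [mul_assoc (idem x y j), ← e1, ← mul_assoc (idem x y j), ← e2]
    simp only [mul_assoc]
  rw [e3, H.idem_mul_y_pow_mul_x_pow]
  split_ifs with h1 h2 h2
  · rw [h2]; simp [H.idem_mul_idem]
  · obtain ⟨d, hd⟩ : ∃ d, k - p - (l - q) = d + 1 := ⟨k - p - (l - q) - 1, by omega⟩
    rw [hd, pow_succ, mul_assoc, mul_assoc, H.y_mul_idem]; simp
  · omega
  · simp

/-- The coefficients of an expansion lying in an ideal `P` are, up to the idempotent, in `P`. -/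
theorem coeff_mul_idem_mem (H : OneSidedInverses x y) {T : Set ι} {j : ι} (hj : j ∉ T)
    (P : TwoSidedIdeal A) (b : ℕ × ℕ →₀ sub K x y T) (hb : expand K x y T j b ∈ P) (k l : ℕ) :
    (b (k, l) : A) * idem x y j ∈ P := by
  induction k using Nat.strong_induction_on generalizing l with
  | _ k ih =>
  by_cases hs : (k, l) ∈ b.support
  swap
  · rw [Finsupp.notMem_support_iff.1 hs]
    simp
  have h1 : ∑ p ∈ b.support, idem x y j * y j ^ k * (x j ^ p.1 * (b p * y j ^ p.2)) *
      (x j ^ l * idem x y j) ∈ P := by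
    have := P.mul_mem_right _ (x j ^ l * idem x y j) (P.mul_mem_left (idem x y j * y j ^ k) _ hb)
    rwa [expand_apply, Finsupp.sum, Finset.mul_sum, Finset.sum_mul] at this
  rw [← Finset.add_sum_erase _ _ hs] at h1
  have h2 : ∑ p ∈ b.support.erase (k, l), idem x y j * y j ^ k *
      (x j ^ p.1 * (b p * y j ^ p.2)) * (x j ^ l * idem x y j) ∈ P := by
    refine sum_mem fun p hp => ?_
    rw [H.idem_mul_term_mul_idem hj (b p).2]
    split_ifs with h
    · have hne := Finset.ne_of_mem_erase hp
      refine ih p.1 (lt_of_le_of_ne h.1 fun h' => hne ?_) p.2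
      exact Prod.ext h' (by omega)
    · exact P.zero_mem
  have h3 := P.sub_mem h1 h2
  rw [add_sub_cancel_right, H.idem_mul_term_mul_idem hj (b (k, l)).2] at h3
  simpa using h3

/-- A prime ideal containing `c * idem j` contains `c` or `idem j`. -/
theorem mem_or_idem_mem (H : OneSidedInverses x y) (htop : sub K x y Set.univ = ⊤)
    {P : TwoSidedIdeal A} (hP : tsiPrime P) {T : Set ι} {j : ι} (hj : j ∉ T) {c : A}
    (hc : c ∈ sub K x y T) (h : c * idem x y j ∈ P) : c ∈ P ∨ idem x y j ∈ P := by
  refine hP.mem_or_mem fun s => ?_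
  have hs : s ∈ sub K x y (insert j {j}ᶜ) := by
    have : insert j {j}ᶜ = (Set.univ : Set ι) := by ext i; simp [em]
    rw [this, htop]; trivial
  obtain ⟨b, rfl⟩ := H.exists_expand (by simp) hs
  rw [expand_apply, Finsupp.sum, Finset.mul_sum, Finset.sum_mul]
  refine sum_mem fun p _ => ?_
  have hbc := H.commute_of_mem_sub (j := j) (by simp) (b p).2
  have e1 : c * x j ^ p.1 = x j ^ p.1 * c := (H.commute_of_mem_sub hj hc).1.pow_right _
  rcases Nat.eq_zero_or_pos p.2 with h0 | h0
  · have e2 : (b p : A) * idem x y j = idem x y j * b p := H.commute_idem (by simp) (b p).2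
    rw [h0, pow_zero, mul_one, ← mul_assoc, e1, mul_assoc, mul_assoc, e2, ← mul_assoc c]
    exact P.mul_mem_left _ _ (P.mul_mem_right _ _ h)
  · obtain ⟨d, hd⟩ : ∃ d, p.2 = d + 1 := ⟨p.2 - 1, by omega⟩
    simp only [mul_assoc]
    rw [hd, pow_succ, mul_assoc, H.y_mul_idem]
    simp

variable (x y) in
/-- The set of indices `i` with `1 - x i * y i ∈ P`. -/
def idx (P : TwoSidedIdeal A) : Set ι := {i | idem x y i ∈ P}

/-- The polynomials in the variables indexed by `I` whose image under `χ` lies in `P`. -/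
def trace (χ : MvPolynomial ι K →ₐ[K] A) (P : TwoSidedIdeal A) (I : Set ι) :
    Ideal (MvPolynomial I K) where
  carrier := {f | χ (rename (↑) f) ∈ P}
  add_mem' {f g} hf hg := by
    simpa only [Set.mem_ofPred_eq, map_add] using P.add_mem hf hg
  zero_mem' := by simp
  smul_mem' f g hg := by
    simpa only [Set.mem_ofPred_eq, smul_eq_mul, map_mul] using P.mul_mem_left _ _ hg

theorem mem_trace {χ : MvPolynomial ι K →ₐ[K] A} {P : TwoSidedIdeal A} {I : Set ι}
    {f : MvPolynomial I K} : f ∈ trace χ P I ↔ χ (rename (↑) f) ∈ P := Iff.rfl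

theorem idx_mono {P P' : TwoSidedIdeal A} (h : P ≤ P') : idx x y P ⊆ idx x y P' :=
  fun _ hi => h hi

theorem trace_mono {χ : MvPolynomial ι K →ₐ[K] A} {P P' : TwoSidedIdeal A} (h : P ≤ P')
    (I : Set ι) : trace χ P I ≤ trace χ P' I :=
  fun _ hf => h hf

theorem mem_of_mul_x_mem {P : TwoSidedIdeal A} {i : ι} (hi : i ∈ idx x y P) {a : A}
    (h : a * x i ∈ P) : a ∈ P := by
  have := P.add_mem (P.mul_mem_right _ (y i) h) (P.mul_mem_left a _ hi)
  rwa [idem, mul_sub, mul_one, mul_assoc, add_sub_cancel] at this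

theorem mem_of_mul_monomial_mem {χ : MvPolynomial ι K →ₐ[K] A} (hχ : ∀ i, χ (X i) = x i)
    {P : TwoSidedIdeal A} {I : Set ι} (hI : I ⊆ idx x y P) (α : I →₀ ℕ) {a : A}
    (h : a * χ (rename (↑) (monomial α (1 : K))) ∈ P) : a ∈ P := by
  induction α using Finsupp.induction_linear generalizing a with
  | zero => simpa using h
  | add f g hf hg =>
    refine hf (hg ?_)
    rw [mul_assoc, ← map_mul, ← map_mul, monomial_mul, one_mul]
    exact h
  | single i n =>
    rw [← X_pow_eq_monomial, map_pow, map_pow, rename_X, hχ] at h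
    induction n with
    | zero => simpa using h
    | succ n ih =>
      rw [pow_succ, ← mul_assoc] at h
      exact ih (mem_of_mul_x_mem (hI i.2) h)

theorem exists_mul_monomial_eq (H : OneSidedInverses x y) {χ : MvPolynomial ι K →ₐ[K] A}
    (hχ : ∀ i, χ (X i) = x i) {I : Set ι} {a : A} (ha : a ∈ sub K x y I) :
    ∃ (α : I →₀ ℕ) (f : MvPolynomial I K),
      a * χ (rename (↑) (monomial α (1 : K))) = χ (rename (↑) f) := by
  induction ha using Algebra.adjoin_induction with
  | mem a ha =>
    rcases ha with ⟨i, hi, rfl⟩ | ⟨i, hi, rfl⟩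
    · exact ⟨0, X ⟨i, hi⟩, by simp [hχ]⟩
    · refine ⟨Finsupp.single ⟨i, hi⟩ 1, 1, ?_⟩
      rw [← X, rename_X, hχ, H.inv]; simp
  | algebraMap r => exact ⟨0, C r, by simp [algHom_C]⟩
  | add a b _ _ ha hb =>
    obtain ⟨α, f, hf⟩ := ha
    obtain ⟨β, g, hg⟩ := hb
    refine ⟨α + β, f * monomial β 1 + g * monomial α 1, ?_⟩
    simp only [map_add, map_mul, ← hf, ← hg, mul_assoc, add_mul]
    simp only [← map_mul, monomial_mul, one_mul, add_comm β α]
  | mul a b _ _ ha hb =>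
    obtain ⟨α, f, hf⟩ := ha
    obtain ⟨β, g, hg⟩ := hb
    refine ⟨β + α, f * g, ?_⟩
    have e : (monomial (β + α) (1 : K) : MvPolynomial I K) = monomial β 1 * monomial α 1 := by
      rw [monomial_mul, one_mul]
    rw [e, map_mul, map_mul, mul_assoc, ← mul_assoc b, hg, ← map_mul, ← map_mul, mul_comm g,
      map_mul, map_mul, ← mul_assoc, hf, map_mul, map_mul]

/-- A prime ideal is determined by its index set and its trace. -/
theorem le_of_idx_subset [Finite ι] (H : OneSidedInverses x y)
    (htop : sub K x y Set.univ = ⊤) {χ : MvPolynomial ι K →ₐ[K] A} (hχ : ∀ i, χ (X i) = x i)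
    {P P' : TwoSidedIdeal A} (hP : tsiPrime P) (hI : idx x y P ⊆ idx x y P')
    (ht : ∀ f ∈ trace χ P (idx x y P), χ (rename (↑) f) ∈ P') : P ≤ P' := by
  classical
  have key : ∀ J : Finset ι, (∀ j ∈ J, j ∉ idx x y P) →
      ∀ a ∈ sub K x y (idx x y P ∪ J), a ∈ P → a ∈ P' := by
    intro J
    induction J using Finset.induction_on with
    | empty =>
      intro _ a ha haP
      rw [Finset.coe_empty, Set.union_empty] at ha
      obtain ⟨α, f, hf⟩ := H.exists_mul_monomial_eq hχ ha
      refine mem_of_mul_monomial_mem hχ hI α ?_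
      rw [hf]
      refine ht f ?_
      rw [mem_trace, ← hf]
      exact P.mul_mem_right _ _ haP
    | insert j J hj ih =>
      intro hJ a ha haP
      rw [Finset.coe_insert, Set.union_insert] at ha
      have hjI := hJ j (Finset.mem_insert_self _ _)
      have hjT : j ∉ idx x y P ∪ ↑J := by simp [hj, hjI]
      obtain ⟨b, rfl⟩ := H.exists_expand hjT ha
      rw [expand_apply]
      refine sum_mem fun p _ => P'.mul_mem_left _ _ (P'.mul_mem_right _ _ ?_)
      refine ih (fun i hi => hJ i (Finset.mem_insert_of_mem hi)) _ (b p).2 ?_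
      exact (H.mem_or_idem_mem htop hP hjT (b p).2
        (H.coeff_mul_idem_mem hjT P b haP p.1 p.2)).resolve_right hjI
  intro a ha
  refine key (Set.toFinite (idx x y P)ᶜ).toFinset (by simp) a ?_ ha
  rw [Set.Finite.coe_toFinset, Set.union_compl_self, htop]
  trivial

theorem commutator_x_mem (H : OneSidedInverses x y) (htop : sub K x y Set.univ = ⊤)
    {P : TwoSidedIdeal A} {i : ι} (hi : i ∈ idx x y P) (s : A) : x i * s - s * x i ∈ P := by
  have hs : s ∈ sub K x y Set.univ := htop ▸ trivial
  induction hs using Algebra.adjoin_induction with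
  | mem a ha =>
    rcases ha with ⟨j, -, rfl⟩ | ⟨j, -, rfl⟩
    · rw [(H.comm_xx i j).eq, sub_self]; exact P.zero_mem
    · by_cases hij : i = j
      · subst hij
        rw [H.inv, ← neg_sub]
        exact P.neg_mem hi
      · rw [(H.comm_xy i j hij).eq, sub_self]; exact P.zero_mem
  | algebraMap r => rw [Algebra.commutes, sub_self]; exact P.zero_mem
  | add a b _ _ ha hb =>
    rw [mul_add, add_mul, add_sub_add_comm]; exact P.add_mem ha hb
  | mul a b _ _ ha hb =>
    have := P.add_mem (P.mul_mem_right _ b ha) (P.mul_mem_left a _ hb)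
    rwa [sub_mul, mul_sub, ← mul_assoc a (x i), ← mul_assoc a b, mul_assoc (x i),
      sub_add_sub_cancel] at this

theorem commutator_mem (H : OneSidedInverses x y) (htop : sub K x y Set.univ = ⊤)
    {χ : MvPolynomial ι K →ₐ[K] A} (hχ : ∀ i, χ (X i) = x i)
    {P : TwoSidedIdeal A} {I : Set ι} (hI : I ⊆ idx x y P) (f : MvPolynomial I K) (s : A) :
    χ (rename (↑) f) * s - s * χ (rename (↑) f) ∈ P := by
  induction f using MvPolynomial.induction_on generalizing s with
  | C r =>
    rw [rename_C, algHom_C, Algebra.commutes, sub_self]; exact P.zero_mem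
  | add f g hf hg =>
    rw [map_add, map_add, mul_add, add_mul, add_sub_add_comm]; exact P.add_mem (hf s) (hg s)
  | mul_X f i hf =>
    rw [map_mul, map_mul, rename_X, hχ]
    have := P.add_mem (P.mul_mem_left (χ (rename (↑) f)) _ (H.commutator_x_mem htop (hI i.2) s))
      (P.mul_mem_right _ (x i) (hf s))
    rwa [sub_mul, mul_sub, ← mul_assoc, ← mul_assoc, sub_add_sub_cancel,
      mul_assoc s] at this

theorem trace_isPrime (H : OneSidedInverses x y) (htop : sub K x y Set.univ = ⊤)
    {χ : MvPolynomial ι K →ₐ[K] A} (hχ : ∀ i, χ (X i) = x i)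
    {P : TwoSidedIdeal A} (hP : tsiPrime P) {I : Set ι} (hI : I ⊆ idx x y P) :
    (trace χ P I).IsPrime := by
  refine ⟨?_, fun {f g} hfg => hP.mem_or_mem fun s => ?_⟩
  · rw [Ne, Ideal.eq_top_iff_one, mem_trace, map_one, map_one]
    exact hP.one_notMem
  · have := P.add_mem (P.mul_mem_right _ (χ (rename (↑) g)) (H.commutator_mem htop hχ hI f s))
      (P.mul_mem_left s _ (mem_trace.1 hfg))
    rwa [map_mul, map_mul, sub_mul, ← mul_assoc, sub_add_cancel] at this

theorem X_notMem_trace (H : OneSidedInverses x y) {χ : MvPolynomial ι K →ₐ[K] A}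
    (hχ : ∀ i, χ (X i) = x i) {P : TwoSidedIdeal A} (hP : tsiPrime P) {I : Set ι} (i : I) :
    X i ∉ trace χ P I := fun h => by
  rw [mem_trace, rename_X, hχ] at h
  have := P.mul_mem_left (y i) _ h
  rw [H.inv] at this
  exact hP.one_notMem this

/-- The universal property of an algebra generated by one-sided inverses in which no nonzero
element of `sub T` is annihilated by an idempotent `idem j` with `j ∉ T`. -/
theorem exists_algHom [Finite ι] [Nontrivial A] (H : OneSidedInverses x y)
    (htop : sub K x y Set.univ = ⊤)
    (hfaith : ∀ (T : Set ι) (j : ι), j ∉ T → ∀ b ∈ sub K x y T, b * idem x y j = 0 → b = 0)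
    {B : Type*} [Ring B] [Algebra K B] {x' y' : ι → B} (H' : OneSidedInverses x' y') :
    ∃ φ : A →ₐ[K] B, (∀ i, φ (x i) = x' i) ∧ ∀ i, φ (y i) = y' i := by
  classical
  let X : ι → A × B := fun i => (x i, x' i)
  let Y : ι → A × B := fun i => (y i, y' i)
  have HH : OneSidedInverses X Y :=
    ⟨fun i => Prod.ext (H.inv i) (H'.inv i),
      fun i j h => Prod.ext (H.comm_xy i j h) (H'.comm_xy i j h),
      fun i j => Prod.ext (H.comm_xx i j) (H'.comm_xx i j),
      fun i j => Prod.ext (H.comm_yy i j) (H'.comm_yy i j)⟩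
  have hmap : ∀ T, (sub K X Y T).map (AlgHom.fst K A B) = sub K x y T := by
    intro T
    rw [sub, AlgHom.map_adjoin, Set.image_union, Set.image_image, Set.image_image]
    rfl
  have hinj : ∀ J : Finset ι, ∀ a ∈ sub K X Y J, a.1 = 0 → a = 0 := by
    intro J
    induction J using Finset.induction_on with
    | empty =>
      intro a ha h0
      rw [sub, Finset.coe_empty, Set.image_empty, Set.image_empty, Set.union_empty,
        Algebra.adjoin_empty, Algebra.mem_bot] at ha
      obtain ⟨r, rfl⟩ := ha
      have : algebraMap K A r = 0 := h0
      rw [map_eq_zero_iff _ (algebraMap K A).injective] at this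
      rw [this, map_zero]
    | insert j J hj ih =>
      intro a ha h0
      rw [Finset.coe_insert] at ha
      have hjT : j ∉ (J : Set ι) := by simpa using hj
      obtain ⟨b, rfl⟩ := HH.exists_expand hjT ha
      have hb : b = 0 := by
        ext1 p
        have h1 := HH.coeff_mul_idem_mem hjT (TwoSidedIdeal.ker (AlgHom.fst K A B)) b
          ((TwoSidedIdeal.mem_ker _).2 h0) p.1 p.2
        have h2 : (b p : A × B).1 * idem x y j = 0 := (TwoSidedIdeal.mem_ker _).1 h1
        refine Subtype.ext (ih _ (b p).2 (hfaith J j hjT _ ?_ h2))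
        rw [← hmap]
        exact ⟨_, (b p).2, rfl⟩
      rw [hb, map_zero]
  let π : sub K X Y Set.univ →ₐ[K] A := (AlgHom.fst K A B).comp (sub K X Y Set.univ).val
  have hπ : Function.Bijective π := by
    constructor
    · rw [injective_iff_map_eq_zero]
      intro a ha
      refine Subtype.ext (hinj (Set.toFinite (Set.univ : Set ι)).toFinset a ?_ ha)
      rw [Set.Finite.coe_toFinset]
      exact a.2
    · intro a
      have : a ∈ (sub K X Y Set.univ).map (AlgHom.fst K A B) := by
        rw [hmap, htop]; trivial
      obtain ⟨b, hb, rfl⟩ := this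
      exact ⟨⟨b, hb⟩, rfl⟩
  let E := AlgEquiv.ofBijective π hπ
  have hE : ∀ g, E.symm (π g) = g := fun g => E.symm_apply_apply g
  refine ⟨((AlgHom.snd K A B).comp (sub K X Y Set.univ).val).comp E.symm.toAlgHom,
    fun i => ?_, fun i => ?_⟩
  · have := hE ⟨X i, x_mem_sub trivial⟩
    exact congrArg (fun g : sub K X Y Set.univ => (g : A × B).2) this
  · have := hE ⟨Y i, y_mem_sub trivial⟩
    exact congrArg (fun g : sub K X Y Set.univ => (g : A × B).2) this

end OneSidedInverses

/-- The linear endomorphism lowering the exponent of the `j`-th variable by one and annihilating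
the monomials not involving it. -/
def lower (σ D : Type*) [Field D] (j : σ) : Module.End D (MvPolynomial σ D) where
  toFun v := v.divMonomial (Finsupp.single j 1)
  map_add' u v := add_divMonomial u v _
  map_smul' c v := by ext; simp [coeff_divMonomial]

theorem coeff_lower {σ D : Type*} [Field D] (j : σ) (v : MvPolynomial σ D) (α : σ →₀ ℕ) :
    coeff α (lower σ D j v) = coeff (Finsupp.single j 1 + α) v :=
  coeff_divMonomial _ _ _

theorem oneSidedInverses_lower (σ D : Type*) [Field D] :
    OneSidedInverses (fun j : σ => LinearMap.mulLeft D (X j : MvPolynomial σ D)) (lower σ D) where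
  inv i := by
    refine LinearMap.ext fun v => ?_
    exact X_mul_divMonomial i v
  comm_xy i j h := by
    classical
    refine LinearMap.ext fun v => ?_
    ext α
    simp only [Module.End.mul_apply, LinearMap.mulLeft_apply, coeff_lower, coeff_X_mul']
    have h1 : i ∈ (Finsupp.single j 1 + α).support ↔ i ∈ α.support := by
      simp [h.symm]
    simp only [h1]
    split_ifs with h2
    · congr 1
      rw [add_tsub_assoc_of_le]
      simpa [Nat.one_le_iff_ne_zero] using h2
    · rfl
  comm_xx i j := by
    refine LinearMap.ext fun v => ?_
    simp only [Module.End.mul_apply, LinearMap.mulLeft_apply]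
    ring
  comm_yy i j := by
    refine LinearMap.ext fun v => ?_
    ext α
    simp only [Module.End.mul_apply, coeff_lower]
    rw [← add_assoc, ← add_assoc, add_comm (Finsupp.single j 1)]

theorem Yop_eq_lower (K : Type*) [Field K] (n : ℕ) (i : Fin n) : Yop K n i = lower (Fin n) K i := by
  classical
  refine (basisMonomials (Fin n) K).ext fun α => ?_
  rw [Yop, Module.Basis.constr_basis]
  ext β
  rw [coeff_lower, coe_basisMonomials, coeff_monomial]
  split_ifs with h0 h1 h1
  · have := DFunLike.congr_fun h1 i
    simp at this
    omega
  · simp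
  · rw [h1]; simp
  · rw [coeff_monomial, if_neg]
    rintro rfl
    apply h1
    rw [add_tsub_cancel_of_le]
    simpa [Nat.one_le_iff_ne_zero] using h0

theorem lower_pow_apply_eq_zero {σ D : Type*} [Field D] (j : σ) (v : MvPolynomial σ D) {k : ℕ}
    (hk : v.totalDegree < k) : (lower σ D j ^ k) v = 0 := by
  have key : ∀ k (u : MvPolynomial σ D) α,
      coeff α ((lower σ D j ^ k) u) = coeff (Finsupp.single j k + α) u := by
    intro k
    induction k with
    | zero => simp
    | succ k ih =>
      intro u α
      rw [pow_succ', Module.End.mul_apply, coeff_lower, ih, ← add_assoc, ← Finsupp.single_add]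
  ext α
  rw [key, coeff_zero]
  refine coeff_eq_zero_of_totalDegree_lt (hk.trans_le ?_)
  rw [← Finsupp.degree_apply, map_add, Finsupp.degree_single]
  omega

theorem oneSidedInverses_SnAlg (K : Type*) [Field K] (n : ℕ) :
    OneSidedInverses (xS K n) (yS K n) := by
  have H := oneSidedInverses_lower (Fin n) K
  refine ⟨fun i => Subtype.ext ?_, fun i j h => Subtype.ext ?_, fun i j => Subtype.ext ?_,
    fun i j => Subtype.ext ?_⟩
  · change Yop K n i * Xop K n i = 1
    rw [Yop_eq_lower]; exact H.inv i
  · change Xop K n i * Yop K n j = Yop K n j * Xop K n i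
    rw [Yop_eq_lower]; exact H.comm_xy i j h
  · exact H.comm_xx i j
  · change Yop K n i * Yop K n j = Yop K n j * Yop K n i
    rw [Yop_eq_lower, Yop_eq_lower]; exact H.comm_yy i j

theorem sub_univ_SnAlg (K : Type*) [Field K] (n : ℕ) :
    OneSidedInverses.sub K (xS K n) (yS K n) Set.univ = ⊤ := by
  rw [eq_top_iff]
  rintro ⟨a, ha⟩ -
  induction ha using Algebra.adjoin_induction with
  | mem a ha =>
    rcases ha with ⟨i, rfl⟩ | ⟨i, rfl⟩
    · exact OneSidedInverses.x_mem_sub (x := xS K n) (Set.mem_univ i)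
    · exact OneSidedInverses.y_mem_sub (y := yS K n) (Set.mem_univ i)
  | algebraMap r => exact Subalgebra.algebraMap_mem _ r
  | add a b _ _ ha hb => exact add_mem ha hb
  | mul a b _ _ ha hb => exact mul_mem ha hb

/-- An element of `S_n` not involving `x_j`, `y_j` is not annihilated by `1 - x_j y_j`. -/
theorem SnAlg_faithful (K : Type*) [Field K] (n : ℕ) (T : Set (Fin n)) (j : Fin n) (hj : j ∉ T)
    (b : SnAlg K n) (hb : b ∈ OneSidedInverses.sub K (xS K n) (yS K n) T)
    (h : b * OneSidedInverses.idem (xS K n) (yS K n) j = 0) : b = 0 := by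
  have H := oneSidedInverses_SnAlg K n
  have hc := H.commute_of_mem_sub hj hb
  have hk : ∀ k, b = xS K n j ^ k * b * yS K n j ^ k := by
    intro k
    induction k with
    | zero => simp
    | succ k ih =>
      have h1 : b = xS K n j * b * yS K n j := by
        rw [← hc.1.eq, mul_assoc]
        exact OneSidedInverses.eq_mul_of_mul_idem_eq_zero h
      conv_lhs => rw [ih, h1]
      rw [pow_succ, pow_succ']
      simp only [mul_assoc]
  refine Subtype.ext (LinearMap.ext fun v => ?_)
  rw [hk (v.totalDegree + 1)]
  change (Xop K n j ^ (v.totalDegree + 1) * (b : Module.End K (PolyAlg K n)) *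
    Yop K n j ^ (v.totalDegree + 1)) v = 0
  rw [Module.End.mul_apply, Yop_eq_lower, lower_pow_apply_eq_zero j v (Nat.lt_succ_self _),
    map_zero]

/-- The inclusion of `P_n` in `S_n`. -/
def polyToSnAlg (K : Type*) [Field K] (n : ℕ) : PolyAlg K n →ₐ[K] SnAlg K n :=
  (Algebra.lmul K (PolyAlg K n)).codRestrict (SnAlg K n) fun f => by
    induction f using MvPolynomial.induction_on with
    | C r =>
      rw [← algebraMap_eq, AlgHom.commutes]
      exact Subalgebra.algebraMap_mem _ r
    | add f g hf hg => rw [map_add]; exact add_mem hf hg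
    | mul_X f i hf => rw [map_mul]; exact mul_mem hf (xS K n i).2

theorem polyToSnAlg_X (K : Type*) [Field K] (n : ℕ) (i : Fin n) :
    polyToSnAlg K n (X i) = xS K n i := rfl

open Classical in
/-- The operators on `D[X_j : j ∉ I]` by which `x_i` acts: multiplication by `X_i` for `i ∉ I` and
by the scalar `u i` for `i ∈ I`. -/
def modelX {ι D : Type*} [Field D] (I : Set ι) (u : I → D) (i : ι) :
    Module.End D (MvPolynomial (Iᶜ : Set ι) D) :=
  if h : i ∈ I then algebraMap D _ (u ⟨i, h⟩) else LinearMap.mulLeft D (X ⟨i, h⟩)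

open Classical in
/-- The operators on `D[X_j : j ∉ I]` by which `y_i` acts. -/
def modelY {ι D : Type*} [Field D] (I : Set ι) (u : I → D) (i : ι) :
    Module.End D (MvPolynomial (Iᶜ : Set ι) D) :=
  if h : i ∈ I then algebraMap D _ (u ⟨i, h⟩)⁻¹ else lower _ D ⟨i, h⟩

theorem oneSidedInverses_model {ι D : Type*} [Field D] (I : Set ι) (u : I → D)
    (hu : ∀ i, u i ≠ 0) : OneSidedInverses (modelX I u) (modelY I u) := by
  have H := oneSidedInverses_lower (Iᶜ : Set ι) D
  refine ⟨fun i => ?_, fun i j hij => ?_, fun i j => ?_, fun i j => ?_⟩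
  · by_cases hi : i ∈ I
    · rw [modelX, modelY, dif_pos hi, dif_pos hi, ← map_mul, inv_mul_cancel₀ (hu _), map_one]
    · rw [modelX, modelY, dif_neg hi, dif_neg hi]
      exact H.inv ⟨i, hi⟩
  · by_cases hi : i ∈ I
    · rw [modelX, dif_pos hi]; exact Algebra.commutes _ _
    by_cases hj : j ∈ I
    · rw [modelY, dif_pos hj]; exact (Algebra.commutes _ _).symm
    rw [modelX, modelY, dif_neg hi, dif_neg hj]
    exact H.comm_xy ⟨i, hi⟩ ⟨j, hj⟩ fun h => hij (congrArg Subtype.val h)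
  · by_cases hi : i ∈ I
    · rw [modelX, dif_pos hi]; exact Algebra.commutes _ _
    by_cases hj : j ∈ I
    · rw [modelX, modelX, dif_pos hj]; exact (Algebra.commutes _ _).symm
    rw [modelX, modelX, dif_neg hi, dif_neg hj]
    exact H.comm_xx ⟨i, hi⟩ ⟨j, hj⟩
  · by_cases hi : i ∈ I
    · rw [modelY, dif_pos hi]; exact Algebra.commutes _ _
    by_cases hj : j ∈ I
    · rw [modelY, modelY, dif_pos hj]; exact (Algebra.commutes _ _).symm
    rw [modelY, modelY, dif_neg hi, dif_neg hj]
    exact H.comm_yy ⟨i, hi⟩ ⟨j, hj⟩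

theorem exists_coeff_shift {S σ D : Type*} [Ring S] [Field D]
    (φ : S →+* Module.End D (MvPolynomial σ D)) (y : σ → S) (hy : ∀ j, φ (y j) = lower σ D j)
    (α : σ →₀ ℕ) : ∃ s, ∀ w β, coeff β (φ s w) = coeff (α + β) w := by
  induction α using Finsupp.induction_linear with
  | zero => exact ⟨1, fun w β => by simp⟩
  | add f g hf hg =>
    obtain ⟨s, hs⟩ := hf
    obtain ⟨t, ht⟩ := hg
    refine ⟨s * t, fun w β => ?_⟩
    rw [map_mul, Module.End.mul_apply, hs, ht, ← add_assoc, add_comm g f]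
  | single j n =>
    refine ⟨y j ^ n, fun w β => ?_⟩
    induction n generalizing w β with
    | zero => simp
    | succ n ih =>
      rw [pow_succ', map_mul, Module.End.mul_apply, hy, coeff_lower, ih, ← add_assoc,
        ← Finsupp.single_add]

theorem exists_mul_monomial {S σ D : Type*} [Ring S] [Field D]
    (φ : S →+* Module.End D (MvPolynomial σ D)) (x : σ → S)
    (hx : ∀ j, φ (x j) = LinearMap.mulLeft D (X j)) (δ : σ →₀ ℕ) :
    ∃ s, ∀ w, φ s w = monomial δ 1 * w := by
  induction δ using Finsupp.induction_linear with
  | zero => exact ⟨1, fun w => by simp⟩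
  | add f g hf hg =>
    obtain ⟨s, hs⟩ := hf
    obtain ⟨t, ht⟩ := hg
    refine ⟨s * t, fun w => ?_⟩
    rw [map_mul, Module.End.mul_apply, hs, ht, ← mul_assoc, monomial_mul, one_mul]
  | single j n =>
    refine ⟨x j ^ n, fun w => ?_⟩
    rw [map_pow, hx, ← X_pow_eq_monomial, LinearMap.pow_mulLeft, LinearMap.mulLeft_apply]

/-- The kernel of a ring of operators on `D[X_j]` containing the multiplications by the variables
and the operators `lower` is prime. -/
theorem tsiPrime_ker {S σ D : Type*} [Ring S] [Field D]
    (φ : S →+* Module.End D (MvPolynomial σ D)) (x y : σ → S)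
    (hx : ∀ j, φ (x j) = LinearMap.mulLeft D (X j)) (hy : ∀ j, φ (y j) = lower σ D j) :
    tsiPrime (TwoSidedIdeal.ker φ) := by
  refine tsiPrime_of_mem_or_mem (by rw [TwoSidedIdeal.mem_ker, map_one]; exact one_ne_zero) ?_
  intro a b h
  simp only [TwoSidedIdeal.mem_ker, map_mul] at h ⊢
  by_contra! hcon
  obtain ⟨ha, hb⟩ := hcon
  obtain ⟨δ, hδ⟩ : ∃ δ, φ a (monomial δ 1) ≠ 0 := by
    by_contra! H
    exact ha ((basisMonomials σ D).ext fun δ => by simpa using H δ)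
  obtain ⟨v, hv⟩ : ∃ v, φ b v ≠ 0 := by
    by_contra! H
    exact hb (LinearMap.ext H)
  set w := φ b v with hw
  obtain ⟨α, hα, hmax⟩ := w.support.exists_max_image (fun α => α.degree) (support_nonempty.2 hv)
  obtain ⟨s, hs⟩ := exists_coeff_shift φ y hy α
  obtain ⟨t, ht⟩ := exists_mul_monomial φ x hx δ
  have h1 : φ s w = C (coeff α w) := by
    classical
    ext β
    rw [hs, coeff_C]
    split_ifs with h0
    · rw [← h0, add_zero]
    · by_contra hne
      have := hmax _ (mem_support_iff.2 hne)
      rw [map_add] at this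
      exact h0 ((Finsupp.degree_eq_zero_iff β).1 (by omega)).symm
  have h2 := LinearMap.congr_fun (h (t * s)) v
  rw [map_mul, Module.End.mul_apply, Module.End.mul_apply, Module.End.mul_apply, ← hw, h1, ht,
    mul_comm, ← smul_eq_C_mul, map_smul, LinearMap.zero_apply, smul_eq_zero] at h2
  exact h2.elim (mem_support_iff.1 hα) hδ

/-- The index set of a prime ideal of `S_n`. -/
abbrev SnIdx {K : Type*} [Field K] {n : ℕ} (P : TwoSidedIdeal (SnAlg K n)) : Set (Fin n) :=
  OneSidedInverses.idx (xS K n) (yS K n) P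

/-- The trace of an ideal of `S_n` on the polynomials in the variables indexed by `I`. -/
abbrev SnTrace {K : Type*} [Field K] {n : ℕ} (P : TwoSidedIdeal (SnAlg K n)) (I : Set (Fin n)) :
    Ideal (MvPolynomial I K) :=
  OneSidedInverses.trace (polyToSnAlg K n) P I

theorem exists_prime_of_field {K : Type*} [Field K] {n : ℕ} (I : Set (Fin n)) {D : Type*} [Field D]
    [Algebra K D] (u : I → D) (hu : ∀ i, u i ≠ 0) :
    ∃ P : TwoSidedIdeal (SnAlg K n), tsiPrime P ∧ SnIdx P = I ∧
      SnTrace P I = RingHom.ker (aeval u : MvPolynomial I K →ₐ[K] D) := by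
  classical
  obtain ⟨φ, hx, hy⟩ := (oneSidedInverses_SnAlg K n).exists_algHom (sub_univ_SnAlg K n)
    (SnAlg_faithful K n) (oneSidedInverses_model I u hu)
  refine ⟨TwoSidedIdeal.ker (φ : SnAlg K n →+* Module.End D (MvPolynomial (Iᶜ : Set (Fin n)) D)),
    ?_, ?_, ?_⟩
  · refine tsiPrime_ker _ (fun j => xS K n j) (fun j => yS K n j) (fun j => ?_) fun j => ?_
    · exact (hx j).trans (dif_neg j.2)
    · exact (hy j).trans (dif_neg j.2)
  · ext i
    have h1 : i ∈ SnIdx (TwoSidedIdeal.ker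
        (φ : SnAlg K n →+* Module.End D (MvPolynomial (Iᶜ : Set (Fin n)) D))) ↔
        1 - modelX I u i * modelY I u i = 0 := by
      rw [← hx, ← hy, ← map_mul, ← map_one φ, ← map_sub]
      exact TwoSidedIdeal.mem_ker _
    rw [h1]
    by_cases hi : i ∈ I
    · rw [modelX, modelY, dif_pos hi, dif_pos hi, ← map_mul, mul_inv_cancel₀ (hu _)]
      simp [hi]
    · rw [modelX, modelY, dif_neg hi, dif_neg hi]
      refine iff_of_false (fun h => ?_) hi
      have h2 := congrArg (coeff 0) (LinearMap.congr_fun h 1)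
      simp [coeff_X_mul'] at h2
  · ext f
    have h1 : ∀ f : MvPolynomial I K, φ (polyToSnAlg K n (rename (↑) f)) =
        algebraMap D (Module.End D (MvPolynomial (Iᶜ : Set (Fin n)) D)) (aeval u f) := by
      intro f
      induction f using MvPolynomial.induction_on with
      | C r =>
        rw [rename_C, aeval_C, ← algebraMap_eq, AlgHom.commutes, AlgHom.commutes,
          ← IsScalarTower.algebraMap_apply]
      | add f g hf hg => simp only [map_add, hf, hg]
      | mul_X f i hf =>
        rw [map_mul, map_mul, map_mul, hf, rename_X, polyToSnAlg_X, hx, map_mul, map_mul,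
          aeval_X, modelX, dif_pos i.2]
    rw [OneSidedInverses.mem_trace, TwoSidedIdeal.mem_ker, RingHom.mem_ker]
    change φ (polyToSnAlg K n (rename (↑) f)) = 0 ↔ _
    rw [h1, map_eq_zero_iff _ (algebraMap D _).injective]

theorem exists_prime_of_trace {K : Type*} [Field K] {n : ℕ} (I : Set (Fin n))
    (q : Ideal (MvPolynomial I K)) [q.IsPrime] (hq : ∀ i, X i ∉ q) :
    ∃ P : TwoSidedIdeal (SnAlg K n), tsiPrime P ∧ SnIdx P = I ∧ SnTrace P I = q := by
  have hinj := IsFractionRing.injective (MvPolynomial I K ⧸ q)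
    (FractionRing (MvPolynomial I K ⧸ q))
  obtain ⟨P, hP, hI, ht⟩ := exists_prime_of_field (K := K) I
    (D := FractionRing (MvPolynomial I K ⧸ q))
    (fun i => algebraMap (MvPolynomial I K ⧸ q) _ (Ideal.Quotient.mk q (X i)))
    fun i h => hq i (Ideal.Quotient.eq_zero_iff_mem.1 ((map_eq_zero_iff _ hinj).1 h))
  refine ⟨P, hP, hI, ht.trans ?_⟩
  have h1 : (aeval fun i => algebraMap (MvPolynomial I K ⧸ q)
      (FractionRing (MvPolynomial I K ⧸ q)) (Ideal.Quotient.mk q (X i))) =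
      (Algebra.algHom K (MvPolynomial I K ⧸ q) (FractionRing (MvPolynomial I K ⧸ q))).comp
        (Ideal.Quotient.mkₐ K q) := by
    refine MvPolynomial.algHom_ext fun i => ?_
    rw [aeval_X]; rfl
  ext f
  rw [RingHom.mem_ker, h1]
  exact (map_eq_zero_iff _ hinj).trans Ideal.Quotient.eq_zero_iff_mem

theorem Sn_le_of_idx_subset {K : Type*} [Field K] {n : ℕ} {P P' : TwoSidedIdeal (SnAlg K n)}
    (hP : tsiPrime P) (hI : SnIdx P ⊆ SnIdx P')
    (ht : ∀ f ∈ SnTrace P (SnIdx P), polyToSnAlg K n (rename (↑) f) ∈ P') : P ≤ P' :=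
  (oneSidedInverses_SnAlg K n).le_of_idx_subset (sub_univ_SnAlg K n) (polyToSnAlg_X K n) hP hI ht

theorem SnTrace_isPrime {K : Type*} [Field K] {n : ℕ} {P : TwoSidedIdeal (SnAlg K n)}
    (hP : tsiPrime P) {I : Set (Fin n)} (hI : I ⊆ SnIdx P) : (SnTrace P I).IsPrime :=
  (oneSidedInverses_SnAlg K n).trace_isPrime (sub_univ_SnAlg K n) (polyToSnAlg_X K n) hP hI

theorem X_notMem_SnTrace {K : Type*} [Field K] {n : ℕ} {P : TwoSidedIdeal (SnAlg K n)}
    (hP : tsiPrime P) {I : Set (Fin n)} (i : I) : X i ∉ SnTrace P I :=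
  (oneSidedInverses_SnAlg K n).X_notMem_trace (polyToSnAlg_X K n) hP i

/-- The Krull dimension of a ring as a natural number, `0` if it is infinite. -/
def natKrullDim (A : Type*) [CommRing A] : ℕ := ((ringKrullDim A).unbotD 0).toNat

theorem natKrullDim_of_eq {A : Type*} [CommRing A] {d : ℕ} (h : ringKrullDim A = d) :
    natKrullDim A = d := by
  rw [natKrullDim, h]; rfl

theorem coe_natKrullDim {K σ : Type*} [Field K] [Finite σ] (q : Ideal (MvPolynomial σ K))
    [q.IsPrime] : ringKrullDim (MvPolynomial σ K ⧸ q) = natKrullDim (MvPolynomial σ K ⧸ q) := by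
  have h1 : ringKrullDim (MvPolynomial σ K ⧸ q) ≤ (Nat.card σ : ℕ) := by
    refine (ringKrullDim_quotient_le q).trans ?_
    rw [MvPolynomial.ringKrullDim_of_isNoetherianRing, ringKrullDim_eq_zero_of_field, zero_add]
  have h2 : 0 ≤ ringKrullDim (MvPolynomial σ K ⧸ q) := ringKrullDim_nonneg_of_nontrivial
  obtain ⟨d, hd⟩ : ∃ d : ℕ, ringKrullDim (MvPolynomial σ K ⧸ q) = d := by
    obtain ⟨e, he⟩ := WithBot.ne_bot_iff_exists.1
      (ne_of_gt (lt_of_lt_of_le (WithBot.bot_lt_coe 0) h2))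
    rw [← he] at h1 ⊢
    have h3 : e ≤ (Nat.card σ : ℕ) := by exact_mod_cast h1
    obtain ⟨d, rfl⟩ := ENat.ne_top_iff_exists.1 (ne_top_of_le_ne_top (ENat.natCast_ne_top _) h3)
    exact ⟨d, rfl⟩
  rw [natKrullDim_of_eq hd, hd]

theorem natKrullDim_quotient_lt {K σ : Type*} [Field K] [Finite σ]
    {q q' : Ideal (MvPolynomial σ K)} [q.IsPrime] [q'.IsPrime] (h : q < q') :
    natKrullDim (MvPolynomial σ K ⧸ q') < natKrullDim (MvPolynomial σ K ⧸ q) := by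
  have := ringKrullDim_quotient_add_one_le q q' h
  rw [coe_natKrullDim q, coe_natKrullDim q'] at this
  exact_mod_cast this

theorem map_rename_inclusion {K τ : Type*} [Field K] [Finite τ] {I I' : Set τ} (h : I ⊆ I')
    (q : Ideal (MvPolynomial I K)) [q.IsPrime] :
    (q.map (rename (R := K) (Set.inclusion h))).IsPrime ∧
      natKrullDim (MvPolynomial I' K ⧸ q.map (rename (R := K) (Set.inclusion h))) =
        natKrullDim (MvPolynomial I K ⧸ q) + (I' \ I).ncard := by
  classical
  let e : ↥(I' \ I) ⊕ I ≃ I' := (Equiv.sumComm _ _).trans (Equiv.Set.sumDiffSubset h)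
  have he : e ∘ Sum.inr = Set.inclusion h := by
    ext i
    simp [e]
  have H := MvPolynomial.map_rename_isPrime (K := K) e q
  rw [he, coe_natKrullDim q] at H
  refine ⟨H.1, natKrullDim_of_eq ?_⟩
  rw [H.2, Nat.card_coe_set_eq]
  push_cast
  rfl

theorem map_SnTrace_le {K : Type*} [Field K] {n : ℕ} {P P' : TwoSidedIdeal (SnAlg K n)}
    (h : P ≤ P') {I I' : Set (Fin n)} (hI : I ⊆ I') :
    (SnTrace P I).map (rename (R := K) (Set.inclusion hI)) ≤ SnTrace P' I' := by
  refine Ideal.map_le_iff_le_comap.2 fun f hf => ?_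
  rw [Ideal.mem_comap, OneSidedInverses.mem_trace, rename_rename]
  exact h hf

/-- The rank of a prime ideal of `S_n`. -/
def SnRank {K : Type*} [Field K] {n : ℕ} (P : TwoSidedIdeal (SnAlg K n)) : ℕ :=
  natKrullDim (MvPolynomial (SnIdx P) K ⧸ SnTrace P (SnIdx P)) + 2 * (SnIdx P)ᶜ.ncard

theorem SnRank_eq {K : Type*} [Field K] {n : ℕ} {P : TwoSidedIdeal (SnAlg K n)} {I : Set (Fin n)}
    (h : SnIdx P = I) :
    SnRank P = natKrullDim (MvPolynomial I K ⧸ SnTrace P I) + 2 * Iᶜ.ncard := by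
  subst h; rfl

theorem SnTrace_lt {K : Type*} [Field K] {n : ℕ} {P P' : TwoSidedIdeal (SnAlg K n)}
    (hP' : tsiPrime P') (h : P < P') (hI : SnIdx P' = SnIdx P) :
    SnTrace P (SnIdx P) < SnTrace P' (SnIdx P) := by
  refine lt_of_le_not_ge (OneSidedInverses.trace_mono h.le _) fun H => h.not_ge ?_
  refine Sn_le_of_idx_subset hP' hI.le ?_
  rw [hI]
  exact fun f hf => H hf

theorem SnRank_lt_of_idx_eq {K : Type*} [Field K] {n : ℕ} {P P' : TwoSidedIdeal (SnAlg K n)}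
    (hP : tsiPrime P) (hP' : tsiPrime P') (h : P < P') (hI : SnIdx P' = SnIdx P) :
    SnRank P' < SnRank P := by
  have := SnTrace_isPrime hP (I := SnIdx P) subset_rfl
  have := SnTrace_isPrime hP' hI.ge
  rw [SnRank_eq hI, SnRank]
  have := natKrullDim_quotient_lt (SnTrace_lt hP' h hI)
  omega

theorem exists_prime_of_idx {K : Type*} [Field K] {n : ℕ} {P P' : TwoSidedIdeal (SnAlg K n)}
    (hP : tsiPrime P) (hP' : tsiPrime P') (h : P ≤ P') {J : Set (Fin n)} (hJ : SnIdx P ⊆ J)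
    (hJ' : J ⊆ SnIdx P') :
    ∃ Q, tsiPrime Q ∧ SnIdx Q = J ∧ P ≤ Q ∧ Q ≤ P' ∧ SnRank Q + (J \ SnIdx P).ncard = SnRank P := by
  have := SnTrace_isPrime hP (I := SnIdx P) subset_rfl
  obtain ⟨hq, hd⟩ := map_rename_inclusion hJ (SnTrace P (SnIdx P))
  have hle := map_SnTrace_le h hJ
  obtain ⟨Q, hQ, hQJ, ht⟩ := exists_prime_of_trace J _
    fun i hi => X_notMem_SnTrace hP' i (hle hi)
  refine ⟨Q, hQ, hQJ, ?_, ?_, ?_⟩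
  · refine Sn_le_of_idx_subset hP (hQJ ▸ hJ) fun f hf => ?_
    have := Ideal.mem_map_of_mem (rename (R := K) (Set.inclusion hJ)) hf
    rw [← ht, OneSidedInverses.mem_trace, rename_rename] at this
    exact this
  · refine Sn_le_of_idx_subset hQ (hQJ ▸ hJ') ?_
    rw [hQJ, ht]
    exact fun f hf => hle hf
  · rw [SnRank_eq hQJ, ht, hd, SnRank]
    have h1 : (SnIdx P)ᶜ.ncard = Jᶜ.ncard + (J \ SnIdx P).ncard := by
      have hdisj : Disjoint Jᶜ (J \ SnIdx P) := Set.disjoint_left.2 fun i hi hi' => hi hi'.1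
      rw [← Set.ncard_union_eq hdisj]
      congr 1
      ext i
      by_cases hi : i ∈ J
      · simp [hi]
      · simpa [hi] using fun h' => hi (hJ h')
    omega

theorem SnRank_lt {K : Type*} [Field K] {n : ℕ} {P P' : TwoSidedIdeal (SnAlg K n)}
    (hP : tsiPrime P) (hP' : tsiPrime P') (h : P < P') : SnRank P' < SnRank P := by
  by_cases hI : SnIdx P' = SnIdx P
  · exact SnRank_lt_of_idx_eq hP hP' h hI
  have hsub : SnIdx P ⊆ SnIdx P' := OneSidedInverses.idx_mono h.le
  obtain ⟨Q, hQ, hQI, -, hQP', hr⟩ := exists_prime_of_idx hP hP' h.le hsub subset_rfl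
  have h1 : 0 < (SnIdx P' \ SnIdx P).ncard := by
    rw [Set.ncard_pos, Set.sdiff_nonempty]
    exact fun h' => hI (h'.antisymm hsub)
  rcases hQP'.eq_or_lt with rfl | hlt
  · omega
  · have := SnRank_lt_of_idx_eq hQ hP' hlt hQI.symm
    omega

theorem exists_prime_between {K : Type*} [Field K] {n : ℕ} {P P' : TwoSidedIdeal (SnAlg K n)}
    (hP : tsiPrime P) (hP' : tsiPrime P') (h : P < P') (hr : SnRank P' + 1 < SnRank P) :
    ∃ Q, tsiPrime Q ∧ P < Q ∧ Q < P' := by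
  by_cases hI : SnIdx P' = SnIdx P
  · have h1 := SnTrace_isPrime hP (I := SnIdx P) subset_rfl
    have h2 := SnTrace_isPrime hP' hI.ge
    rw [SnRank_eq hI, SnRank] at hr
    obtain ⟨r, hprime, hlt, hlt'⟩ := exists_prime_between_of_ringKrullDim (K := K) _ _
      (SnTrace_lt hP' h hI) (by
        rw [coe_natKrullDim (SnTrace P (SnIdx P)), coe_natKrullDim (SnTrace P' (SnIdx P))]
        have : natKrullDim (MvPolynomial (SnIdx P) K ⧸ SnTrace P' (SnIdx P)) + 1 <
          natKrullDim (MvPolynomial (SnIdx P) K ⧸ SnTrace P (SnIdx P)) := by omega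
        exact_mod_cast this)
    obtain ⟨Q, hQ, hQI, ht⟩ := exists_prime_of_trace _ r
      fun i hi => X_notMem_SnTrace hP' i (hlt'.le hi)
    refine ⟨Q, hQ, lt_of_le_of_ne ?_ ?_, lt_of_le_of_ne ?_ ?_⟩
    · refine Sn_le_of_idx_subset hP hQI.ge fun f hf => ?_
      have : f ∈ SnTrace Q (SnIdx P) := by rw [ht]; exact hlt.le hf
      exact this
    · rintro rfl
      exact hlt.ne ht
    · refine Sn_le_of_idx_subset hQ (hQI.trans hI.symm).le ?_
      rw [hQI, ht]
      exact fun f hf => hlt'.le hf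
    · rintro rfl
      exact hlt'.ne ht.symm
  · have hsub : SnIdx P ⊆ SnIdx P' := OneSidedInverses.idx_mono h.le
    obtain ⟨i, hi, hi'⟩ := Set.not_subset.1 fun h' => hI (h'.antisymm hsub)
    obtain ⟨Q, hQ, -, hPQ, hQP', hrQ⟩ := exists_prime_of_idx hP hP' h.le
      (Set.subset_insert i _) (Set.insert_subset hi hsub)
    have h1 : (insert i (SnIdx P) \ SnIdx P).ncard = 1 := by
      rw [Set.ncard_eq_one]
      refine ⟨i, ?_⟩
      rw [Set.insert_sdiff_of_notMem _ hi', Set.sdiff_self, insert_empty_eq]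
    refine ⟨Q, hQ, lt_of_le_of_ne hPQ ?_, lt_of_le_of_ne hQP' ?_⟩
    · rintro rfl; omega
    · rintro rfl; omega

theorem exists_minimum_prime (K : Type*) [Field K] (n : ℕ) :
    ∃ P₀ : TwoSidedIdeal (SnAlg K n), tsiPrime P₀ ∧ ∀ P, tsiPrime P → P₀ ≤ P := by
  obtain ⟨P₀, h0, hI, ht⟩ := exists_prime_of_trace (K := K) (∅ : Set (Fin n)) ⊥ fun i => i.2.elim
  refine ⟨P₀, h0, fun P _ => Sn_le_of_idx_subset h0 (hI ▸ Set.empty_subset _) ?_⟩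
  rw [hI, ht]
  intro f hf
  rw [Ideal.mem_bot.1 hf, map_zero, map_zero]
  exact P.zero_mem

/-- the relative height function on primes of `S_n` is additive and `S_n` is
catenary: for primes `P₁ ⊆ P₂ ⊆ P₃`, `ht(P₃,P₁) = ht(P₃,P₂) + ht(P₂,P₁)` and
`ht(P₂,P₁) = ht(P₂) − ht(P₁)`; moreover every chain of primes from `P₁` to `P₃` admits a
refinement of length `ht(P₃,P₁)`. -/
theorem statement9 (K : Type u) [Field K] (n : ℕ) (hn : 0 < n)
    (P₁ P₂ P₃ : TwoSidedIdeal (SnAlg K n))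
    (h1 : tsiPrime P₁) (h2 : tsiPrime P₂) (h3 : tsiPrime P₃)
    (h12 : P₁ ≤ P₂) (h23 : P₂ ≤ P₃) :
    ∃ r12 r23 r13 ht1 ht2 : ℕ,
      relHeightIs P₁ P₂ r12 ∧ relHeightIs P₂ P₃ r23 ∧ relHeightIs P₁ P₃ r13 ∧
      heightIs P₁ ht1 ∧ heightIs P₂ ht2 ∧
      r13 = r23 + r12 ∧
      r12 + ht1 = ht2 ∧
      ∀ (m : ℕ) (g : Fin (m + 1) → TwoSidedIdeal (SnAlg K n)),
        StrictMono g → (∀ i, tsiPrime (g i)) → g 0 = P₁ → g (Fin.last m) = P₃ →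
        ∃ f : Fin (r13 + 1) → TwoSidedIdeal (SnAlg K n),
          StrictMono f ∧ (∀ i, tsiPrime (f i)) ∧ f 0 = P₁ ∧ f (Fin.last r13) = P₃ ∧
          Set.range g ⊆ Set.range f := by
  exact additive_of_rank SnRank (fun _ _ => SnRank_lt) (fun _ _ => exists_prime_between)
    (exists_minimum_prime K n) P₁ P₂ P₃ h1 h2 h3 h12 h23
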